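/- Let (X,d_X) and (Y,d_Y) be bounded metric spaces, each with at least two points, let k > 0, and let T : LPM_k(X,d_X) → LPM_k(Y,d_Y) be a bijective sup-metric isometry satisfying T(Pp(X) ∩ LPM_k(X,d_X)) = Pp(Y) ∩ LPM_k(Y,d_Y). Then there exists a bijection Φ from the set D(Y) of two-element subsets of Y onto the set D(X) of two-element subsets of X such that for every d ∈ LPM_k(X,d_X) and every {x,y} ∈ D(Y), if Φ({x,y}) = {z,w} then T(d)(x,y) = d(z,w). -/

import Mathlib

open Set Filter

namespace BanachStone

/-- `d` is a pseudometric. -/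
def IsPseudometric {Z : Type*} (d : Z → Z → ℝ) : Prop :=
  (∀ z, d z z = 0) ∧ (∀ z w, d z w = d w z) ∧ (∀ z w v, d z v ≤ d z w + d w v)

/-- `d` is bounded. -/
def IsBoundedPM {Z : Type*} (d : Z → Z → ℝ) : Prop := ∃ C : ℝ, ∀ z w, d z w ≤ C

/-- The sup-norm of `d`. -/
noncomputable def supNorm {Z : Type*} (d : Z → Z → ℝ) : ℝ := ⨆ p : Z × Z, d p.1 p.2

/-- The sup-metric between `d` and `ρ`. -/
noncomputable def supDist {Z : Type*} (d ρ : Z → Z → ℝ) : ℝ :=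
  ⨆ p : Z × Z, |d p.1 p.2 - ρ p.1 p.2|

/-- `PM Z`: bounded continuous pseudometrics on `Z`. -/
def PM (Z : Type*) [TopologicalSpace Z] : Set (Z → Z → ℝ) :=
  {d | IsPseudometric d ∧ IsBoundedPM d ∧ Continuous fun p : Z × Z => d p.1 p.2}

/-- The topology induced by `d` (generated by open `d`-balls). -/
def metricTopology {Z : Type*} (d : Z → Z → ℝ) : TopologicalSpace Z :=
  TopologicalSpace.generateFrom {s | ∃ z : Z, ∃ r : ℝ, s = {w | d z w < r}}

/-- `AM Z`: admissible metrics, i.e. bounded metrics inducing the topology of `Z`. -/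
def AM (Z : Type*) [t : TopologicalSpace Z] : Set (Z → Z → ℝ) :=
  {d | IsPseudometric d ∧ IsBoundedPM d ∧ (∀ z w : Z, z ≠ w → 0 < d z w) ∧
    metricTopology d = t}

/-- `Pp Z`: elements of `PM Z` attaining the sup-norm at exactly one unordered pair
of distinct points. -/
def Pp (Z : Type*) [TopologicalSpace Z] : Set (Z → Z → ℝ) :=
  {d | d ∈ PM Z ∧ ∃ z w : Z, z ≠ w ∧ d z w = supNorm d ∧
    ∀ z' w' : Z, z' ≠ w' → d z' w' = supNorm d → ({z', w'} : Set Z) = {z, w}}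

/-- `UPM Z`: bounded pseudometrics uniformly continuous w.r.t. the uniformity of `Z`. -/
def UPM (Z : Type*) [UniformSpace Z] : Set (Z → Z → ℝ) :=
  {d | IsPseudometric d ∧ IsBoundedPM d ∧
    ∀ ε : ℝ, 0 < ε → ∃ U ∈ uniformity Z, ∀ x y : Z, (x, y) ∈ U → d x y < ε}

/-- `UC Z`: bounded uniformly continuous real-valued functions on `Z`. -/
def UC (Z : Type*) [UniformSpace Z] : Set (Z → ℝ) :=
  {f | (∃ C : ℝ, ∀ z, |f z| ≤ C) ∧ UniformContinuous f}

/-- The space `U(Z)`. -/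
def Ucal (Z : Type*) [UniformSpace Z] : Set (Z → Z → ℝ) :=
  {d | d ∈ PM Z ∧ ∀ ε : ℝ, 0 < ε → ∃ F : Finset (Z → ℝ), F.Nonempty ∧
    (↑F : Set (Z → ℝ)) ⊆ UC Z ∧ ∃ δ : ℝ, 0 < δ ∧
    ∀ x y : Z, (∀ f ∈ F, |f x - f y| < δ) → d x y < ε}

/-- The uniformity filter of the coarsest uniformity on `Z` making every bounded
uniformly continuous real-valued function on `Z` uniformly continuous. -/
noncomputable def U0 (Z : Type*) [UniformSpace Z] : Filter (Z × Z) :=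
  ⨅ f ∈ UC Z, Filter.comap (fun p : Z × Z => (f p.1, f p.2)) (uniformity ℝ)

/-- The Lipschitz constant of a pseudometric on a metric space. -/
noncomputable def lip {Z : Type*} [PseudoMetricSpace Z] (d : Z → Z → ℝ) : ENNReal :=
  ⨆ (x : Z) (y : Z) (_ : x ≠ y), ENNReal.ofReal (d x y / dist x y)

/-- `LPM Z`: bounded Lipschitz continuous pseudometrics on `Z`. -/
def LPM (Z : Type*) [MetricSpace Z] : Set (Z → Z → ℝ) :=
  {d | IsPseudometric d ∧ IsBoundedPM d ∧ lip d < ⊤}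

/-- `LPM_k Z`: elements of `LPM Z` with Lipschitz constant `< k`. -/
def LPMlt (k : ℝ) (Z : Type*) [MetricSpace Z] : Set (Z → Z → ℝ) :=
  {d | d ∈ LPM Z ∧ lip d < ENNReal.ofReal k}

/-- `\overline{LPM}_k Z`: elements of `LPM Z` with Lipschitz constant `≤ k`. -/
def LPMle (k : ℝ) (Z : Type*) [MetricSpace Z] : Set (Z → Z → ℝ) :=
  {d | d ∈ LPM Z ∧ lip d ≤ ENNReal.ofReal k}

/-- `Z` has exactly two points. -/
def ExactlyTwo (Z : Type*) : Prop := ∃ a b : Z, a ≠ b ∧ ∀ c : Z, c = a ∨ c = b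

/-- The two-element subsets of `Z`. -/
def Dset (Z : Type*) : Set (Set Z) := {s | ∃ a b : Z, a ≠ b ∧ s = {a, b}}

section Pseudometrics

variable {Z : Type*} {d e : Z → Z → ℝ}

lemma IsPseudometric.nonneg (hd : IsPseudometric d) (z w : Z) : 0 ≤ d z w := by
  have h := hd.2.2 z w z
  rw [hd.1, hd.2.1 w z] at h
  linarith

lemma IsPseudometric.eq_of_pair_eq (hd : IsPseudometric d) {a b a' b' : Z}
    (h : ({a, b} : Set Z) = {a', b'}) : d a b = d a' b' := by
  rcases Set.pair_eq_pair_iff.1 h with ⟨rfl, rfl⟩ | ⟨rfl, rfl⟩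
  · rfl
  · exact hd.2.1 _ _

lemma le_supNorm (hd : IsBoundedPM d) (z w : Z) : d z w ≤ supNorm d := by
  obtain ⟨C, hC⟩ := hd
  exact le_ciSup (f := fun p : Z × Z => d p.1 p.2) ⟨C, by rintro _ ⟨p, rfl⟩; exact hC _ _⟩ (z, w)

lemma supNorm_le [Nonempty Z] {C : ℝ} (h : ∀ z w, d z w ≤ C) : supNorm d ≤ C :=
  ciSup_le fun p => h p.1 p.2

lemma supDist_le [Nonempty Z] {C : ℝ} (h : ∀ z w, |d z w - e z w| ≤ C) : supDist d e ≤ C :=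
  ciSup_le fun p => h p.1 p.2

lemma abs_sub_le_supDist (hd : IsPseudometric d) (he : IsPseudometric e)
    (hdb : IsBoundedPM d) (heb : IsBoundedPM e) (z w : Z) :
    |d z w - e z w| ≤ supDist d e := by
  obtain ⟨C, hC⟩ := hdb
  obtain ⟨C', hC'⟩ := heb
  refine le_ciSup (f := fun p : Z × Z => |d p.1 p.2 - e p.1 p.2|) ⟨C + C', ?_⟩ (z, w)
  rintro _ ⟨p, rfl⟩
  have h1 := hC p.1 p.2
  have h2 := hC' p.1 p.2
  have h3 := hd.nonneg p.1 p.2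
  have h4 := he.nonneg p.1 p.2
  exact abs_le.2 ⟨by linarith, by linarith⟩

lemma isPseudometric_zero : IsPseudometric (0 : Z → Z → ℝ) := by
  simp [IsPseudometric]

lemma IsPseudometric.min_const (hd : IsPseudometric d) {s : ℝ} (hs : 0 ≤ s) :
    IsPseudometric fun z w => min s (d z w) := by
  refine ⟨fun z => by simp [hd.1, hs], fun z w => by simp only [hd.2.1 z w], fun z w v => ?_⟩
  have h := hd.2.2 z w v
  have h1 := hd.nonneg z w
  have h2 := hd.nonneg w v
  grind

lemma IsPseudometric.add (hd : IsPseudometric d) (he : IsPseudometric e) :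
    IsPseudometric (d + e) := by
  refine ⟨fun z => by simp [hd.1, he.1], fun z w => ?_, fun z w v => ?_⟩
  · simp [hd.2.1 z w, he.2.1 z w]
  · have h1 := hd.2.2 z w v
    have h2 := he.2.2 z w v
    simp only [Pi.add_apply]
    linarith

lemma IsPseudometric.smul (hd : IsPseudometric d) {t : ℝ} (ht : 0 ≤ t) :
    IsPseudometric (t • d) := by
  refine ⟨fun z => by simp [hd.1], fun z w => ?_, fun z w v => ?_⟩
  · simp [hd.2.1 z w]
  · have h1 := mul_le_mul_of_nonneg_left (hd.2.2 z w v) ht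
    simp only [Pi.smul_apply, smul_eq_mul]
    linarith

/-- Identifying the points `a` and `b` in a pseudometric space. -/
lemma IsPseudometric.collapse (hd : IsPseudometric d) (a b : Z) :
    IsPseudometric fun z w => min (d z w) (min (d z a + d b w) (d z b + d a w)) := by
  have hn := hd.nonneg
  have hs := hd.2.1
  have ht := hd.2.2
  refine ⟨fun z => ?_, fun z w => ?_, fun z w v => ?_⟩
  · simp only [hd.1 z]
    exact min_eq_left (le_min (add_nonneg (hn _ _) (hn _ _)) (add_nonneg (hn _ _) (hn _ _)))
  · simp only
    rw [hs z w, hs z a, hs z b, hs b w, hs a w, min_comm (d a z + d w b), add_comm (d a z),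
      add_comm (d b z)]
  · have h1 := ht z w v
    have h2 := ht z w a
    have h3 := ht z w b
    have h4 := ht a w v
    have h5 := ht b w v
    have h6 := ht z a v
    have h7 := ht z b v
    have h8 := hs w a
    have h9 := hs w b
    have h10 := hn w a
    have h11 := hn w b
    grind

/-- Adding a constant to a pseudometric off the diagonal, capped by a larger pseudometric. -/
lemma IsPseudometric.min_add_const (hd : IsPseudometric d) (he : IsPseudometric e)
    (hde : ∀ z w, d z w ≤ e z w) {δ : ℝ} (hδ : 0 ≤ δ) :
    IsPseudometric fun z w => min (d z w + δ) (e z w) := by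
  refine ⟨fun z => by simp [hd.1, he.1, hδ], fun z w => by simp only [hd.2.1 z w, he.2.1 z w],
    fun z w v => ?_⟩
  have h1 := hd.2.2 z w v
  have h2 := he.2.2 z w v
  have h3 := hde z w
  have h4 := hde w v
  grind

/-- `d` attains its sup-norm at the pair `{a, b}` and at no other pair. -/
def Peak (d : Z → Z → ℝ) (a b : Z) : Prop :=
  a ≠ b ∧ d a b = supNorm d ∧
    ∀ z w : Z, z ≠ w → d z w = supNorm d → ({z, w} : Set Z) = {a, b}

lemma Peak.pair_eq {a b a' b' : Z} (h : Peak d a b) (h' : Peak d a' b') :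
    ({a, b} : Set Z) = {a', b'} :=
  h'.2.2 a b h.1 h.2.1

lemma Peak.congr_pair (hd : IsPseudometric d) {a b a' b' : Z} (h : Peak d a b)
    (hab : ({a, b} : Set Z) = {a', b'}) : Peak d a' b' := by
  refine ⟨?_, (hd.eq_of_pair_eq hab).symm.trans h.2.1, fun z w hzw hd => ?_⟩
  · rcases Set.pair_eq_pair_iff.1 hab with ⟨rfl, rfl⟩ | ⟨rfl, rfl⟩
    exacts [h.1, h.1.symm]
  · rw [h.2.2 z w hzw hd, hab]

lemma IsBoundedPM.add (hd : IsBoundedPM d) (he : IsBoundedPM e) : IsBoundedPM (d + e) := by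
  obtain ⟨C, hC⟩ := hd
  obtain ⟨C', hC'⟩ := he
  exact ⟨C + C', fun z w => add_le_add (hC z w) (hC' z w)⟩

lemma supNorm_add_of_eq [Nonempty Z] (hdb : IsBoundedPM d) (heb : IsBoundedPM e) {a b : Z}
    (hd : d a b = supNorm d) (he : e a b = supNorm e) :
    supNorm (d + e) = supNorm d + supNorm e := by
  refine le_antisymm (supNorm_le fun z w => add_le_add (le_supNorm hdb z w) (le_supNorm heb z w))
    ?_
  rw [← hd, ← he]
  exact le_supNorm (hdb.add heb) a b

lemma Peak.add_of_eq [Nonempty Z] (hdb : IsBoundedPM d) (heb : IsBoundedPM e) {a b : Z}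
    (hd : d a b = supNorm d) (he : Peak e a b) : Peak (d + e) a b := by
  have hN := supNorm_add_of_eq hdb heb hd he.2.1
  refine ⟨he.1, ?_, fun z w hzw h => he.2.2 z w hzw ?_⟩
  · rw [hN, ← hd, ← he.2.1]
    rfl
  · rw [hN] at h
    simp only [Pi.add_apply] at h
    have h1 := le_supNorm hdb z w
    have h2 := le_supNorm heb z w
    linarith

lemma supNorm_smul {t : ℝ} (ht : 0 ≤ t) : supNorm (t • d) = t * supNorm d :=
  (Real.mul_iSup_of_nonneg ht _).symm

lemma Peak.smul {t : ℝ} (ht : 0 < t) {a b : Z} (h : Peak d a b) : Peak (t • d) a b := by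
  refine ⟨h.1, ?_, fun z w hzw hd => h.2.2 z w hzw ?_⟩
  · simp [supNorm_smul ht.le, h.2.1]
  · rw [supNorm_smul ht.le] at hd
    exact mul_left_cancel₀ ht.ne' hd

lemma supNorm_nonneg [Nonempty Z] (hd : IsPseudometric d) : 0 ≤ supNorm d :=
  Real.iSup_nonneg fun p => hd.nonneg p.1 p.2

lemma supDist_zero_right (hd : IsPseudometric d) : supDist d 0 = supNorm d := by
  unfold supDist supNorm
  congr 1
  ext p
  simp [abs_of_nonneg (hd.nonneg p.1 p.2)]

lemma supDist_zero_left (hd : IsPseudometric d) : supDist 0 d = supNorm d := by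
  unfold supDist supNorm
  congr 1
  ext p
  simp [abs_of_nonneg (hd.nonneg p.1 p.2)]

lemma supDist_add_left_self (he : IsPseudometric e) : supDist (d + e) d = supNorm e := by
  rw [← supDist_zero_right he]
  simp [supDist]

lemma supDist_le_max [Nonempty Z] (hd : IsPseudometric d) (he : IsPseudometric e)
    (hdb : IsBoundedPM d) (heb : IsBoundedPM e) :
    supDist d e ≤ max (supNorm d) (supNorm e) := by
  refine supDist_le fun z w => abs_sub_le_iff.2 ⟨?_, ?_⟩
  · exact le_max_of_le_left (by linarith [le_supNorm hdb z w, he.nonneg z w])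
  · exact le_max_of_le_right (by linarith [le_supNorm heb z w, hd.nonneg z w])

lemma eq_zero_of_supNorm_nonpos (hd : IsPseudometric d) (hdb : IsBoundedPM d)
    (h : supNorm d ≤ 0) : d = 0 := by
  ext z w
  exact le_antisymm ((le_supNorm hdb z w).trans h) (hd.nonneg z w)

/-- If `e` extends a geodesic from `0` through `d`, the peaks of `d` and `e` agree. -/
lemma Peak.pair_eq_of_supDist (hd : IsPseudometric d) (he : IsPseudometric e)
    (hdb : IsBoundedPM d) (heb : IsBoundedPM e) {a b a' b' : Z}
    (hda : Peak d a b) (hea : Peak e a' b') (h : supDist e d = supNorm e - supNorm d) :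
    ({a, b} : Set Z) = {a', b'} := by
  have h1 := (abs_le.1 (abs_sub_le_supDist he hd heb hdb a' b')).2
  rw [h, hea.2.1] at h1
  exact (hda.2.2 a' b' hea.1 (le_antisymm (le_supNorm hdb _ _) (by linarith))).symm

end Pseudometrics

section Lipschitz

variable {Z : Type*} [MetricSpace Z] {k : ℝ} {d e : Z → Z → ℝ}

lemma isPseudometric_dist {c : ℝ} (hc : 0 ≤ c) :
    IsPseudometric fun z w : Z => c * dist z w := by
  refine ⟨fun z => by simp, fun z w => by simp only [dist_comm z w], fun z w v => ?_⟩
  simp only [← mul_add]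
  exact mul_le_mul_of_nonneg_left (dist_triangle _ _ _) hc

lemma exists_bound_of_mem_LPMlt (hd : d ∈ LPMlt k Z) :
    ∃ c, 0 ≤ c ∧ c < k ∧ ∀ z w, d z w ≤ c * dist z w := by
  obtain ⟨⟨hp, -, htop⟩, hlip⟩ := hd
  refine ⟨(lip d).toReal, ENNReal.toReal_nonneg, ENNReal.toReal_lt_of_lt_ofReal hlip,
    fun z w => ?_⟩
  rcases eq_or_ne z w with rfl | hzw
  · simp [hp.1]
  · rw [← div_le_iff₀ (dist_pos.2 hzw), ← ENNReal.ofReal_le_iff_le_toReal htop.ne]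
    exact le_iSup_of_le z (le_iSup_of_le w (le_iSup_of_le hzw le_rfl))

lemma mem_LPMlt (hZ : ∃ C : ℝ, ∀ a b : Z, dist a b ≤ C) (hp : IsPseudometric d) {c : ℝ}
    (hc : 0 ≤ c) (hck : c < k) (h : ∀ z w, d z w ≤ c * dist z w) : d ∈ LPMlt k Z := by
  have hlip : lip d ≤ ENNReal.ofReal c := by
    refine iSup_le fun z => iSup_le fun w => iSup_le fun hzw => ?_
    refine ENNReal.ofReal_le_ofReal ?_
    rw [div_le_iff₀ (dist_pos.2 hzw)]
    exact h z w
  obtain ⟨C, hC⟩ := hZ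
  refine ⟨⟨hp, ⟨c * C, fun z w => (h z w).trans (mul_le_mul_of_nonneg_left (hC z w) hc)⟩,
    hlip.trans_lt ENNReal.ofReal_lt_top⟩, hlip.trans_lt ?_⟩
  exact (ENNReal.ofReal_lt_ofReal_iff_of_nonneg hc).2 hck

lemma mem_LPMlt_of_le (hZ : ∃ C : ℝ, ∀ a b : Z, dist a b ≤ C) (hd : d ∈ LPMlt k Z)
    (he : IsPseudometric e) (hed : ∀ z w, e z w ≤ d z w) : e ∈ LPMlt k Z := by
  obtain ⟨c, hc, hck, h⟩ := exists_bound_of_mem_LPMlt hd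
  exact mem_LPMlt hZ he hc hck fun z w => (hed z w).trans (h z w)

lemma zero_mem_LPMlt (hZ : ∃ C : ℝ, ∀ a b : Z, dist a b ≤ C) (hk : 0 < k) :
    (0 : Z → Z → ℝ) ∈ LPMlt k Z :=
  mem_LPMlt hZ isPseudometric_zero le_rfl hk (by simp)

lemma smul_mem_LPMlt (hZ : ∃ C : ℝ, ∀ a b : Z, dist a b ≤ C) (hd : d ∈ LPMlt k Z) {t : ℝ}
    (ht : 0 ≤ t) (ht1 : t ≤ 1) : t • d ∈ LPMlt k Z :=
  mem_LPMlt_of_le hZ hd (hd.1.1.smul ht) fun z w =>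
    mul_le_of_le_one_left (hd.1.1.nonneg z w) ht1

lemma exists_one_add_smul_mem_LPMlt (hZ : ∃ C : ℝ, ∀ a b : Z, dist a b ≤ C)
    (hd : d ∈ LPMlt k Z) : ∃ ε : ℝ, 0 < ε ∧ (1 + ε) • d ∈ LPMlt k Z := by
  obtain ⟨c, hc, hck, h⟩ := exists_bound_of_mem_LPMlt hd
  have hε : 0 < (k - c) / (2 * (c + 1)) := div_pos (by linarith) (by linarith)
  refine ⟨_, hε, mem_LPMlt hZ (hd.1.1.smul (by linarith)) (c := (c + k) / 2)
    (by linarith) (by linarith) fun z w => ?_⟩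
  have h1 : (1 + (k - c) / (2 * (c + 1))) * c ≤ (c + k) / 2 := by
    have : (k - c) / (2 * (c + 1)) * (2 * (c + 1)) = k - c := div_mul_cancel₀ _ (by linarith)
    nlinarith
  calc (1 + (k - c) / (2 * (c + 1))) * d z w
      ≤ (1 + (k - c) / (2 * (c + 1))) * (c * dist z w) :=
        mul_le_mul_of_nonneg_left (h z w) (by linarith)
    _ = (1 + (k - c) / (2 * (c + 1))) * c * dist z w := by ring
    _ ≤ _ := mul_le_mul_of_nonneg_right h1 dist_nonneg

lemma convexCombo_mem_LPMlt (hZ : ∃ C : ℝ, ∀ a b : Z, dist a b ≤ C) (hd : d ∈ LPMlt k Z)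
    (he : e ∈ LPMlt k Z) {s t : ℝ} (hs : 0 ≤ s) (ht : 0 ≤ t) (hst : s + t = 1) :
    s • d + t • e ∈ LPMlt k Z := by
  obtain ⟨c, hc, hck, h⟩ := exists_bound_of_mem_LPMlt hd
  obtain ⟨c', hc', hck', h'⟩ := exists_bound_of_mem_LPMlt he
  refine mem_LPMlt hZ ((hd.1.1.smul hs).add (he.1.1.smul ht)) (c := max c c')
    (le_max_of_le_left hc) (max_lt hck hck') fun z w => ?_
  have h1 : d z w ≤ max c c' * dist z w :=
    (h z w).trans (mul_le_mul_of_nonneg_right (le_max_left _ _) dist_nonneg)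
  have h2 : e z w ≤ max c c' * dist z w :=
    (h' z w).trans (mul_le_mul_of_nonneg_right (le_max_right _ _) dist_nonneg)
  calc s * d z w + t * e z w
      ≤ s * (max c c' * dist z w) + t * (max c c' * dist z w) :=
        add_le_add (mul_le_mul_of_nonneg_left h1 hs) (mul_le_mul_of_nonneg_left h2 ht)
    _ = max c c' * dist z w := by rw [← add_mul, hst, one_mul]

lemma LPMlt_subset_PM : LPMlt k Z ⊆ PM Z := by
  intro d hd
  obtain ⟨c, hc, -, h⟩ := exists_bound_of_mem_LPMlt hd
  obtain ⟨⟨hp, hb, -⟩, -⟩ := hd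
  refine ⟨hp, hb, ?_⟩
  refine (LipschitzWith.of_dist_le_mul (K := ⟨2 * c, by positivity⟩) fun p q => ?_).continuous
  have h1 := h p.1 q.1
  have h2 := h p.2 q.2
  have h3 : dist p.1 q.1 ≤ dist p q := le_max_left _ _
  have h4 : dist p.2 q.2 ≤ dist p q := le_max_right _ _
  have h5 := mul_le_mul_of_nonneg_left h3 hc
  have h6 := mul_le_mul_of_nonneg_left h4 hc
  have h7 := hp.2.2 p.1 q.1 p.2
  have h8 := hp.2.2 q.1 q.2 p.2
  have h9 := hp.2.2 q.1 p.1 q.2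
  have h10 := hp.2.2 p.1 p.2 q.2
  have h11 := hp.2.1 p.1 q.1
  have h12 := hp.2.1 p.2 q.2
  rw [Real.dist_eq]
  change _ ≤ 2 * c * dist p q
  exact abs_le.2 ⟨by linarith, by linarith⟩

lemma mem_Pp_iff_exists_peak (hd : d ∈ LPMlt k Z) : d ∈ Pp Z ↔ ∃ a b, Peak d a b :=
  ⟨fun h => h.2, fun h => ⟨LPMlt_subset_PM hd, h⟩⟩

lemma exists_peak (hZ : ∃ C : ℝ, ∀ a b : Z, dist a b ≤ C) (hk : 0 < k) {a b : Z}
    (hab : a ≠ b) : ∃ f ∈ LPMlt k Z, Peak f a b := by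
  set r := dist a b with hr
  have hr0 : 0 < r := dist_pos.2 hab
  have : Nonempty Z := ⟨a⟩
  let F : Z → ℝ := fun z => max 0 (r - dist a z) - max 0 (r - dist b z)
  have hFa : F a = r := by simp [F, hr, dist_comm b a]
  have hFb : F b = -r := by simp [F, hr]
  have hle : ∀ z, F z ≤ r := fun z => by
    have := dist_nonneg (x := a) (y := z)
    simp only [F]; grind
  have hge : ∀ z, -r ≤ F z := fun z => by
    have := dist_nonneg (x := b) (y := z)
    simp only [F]; grind
  have heqa : ∀ z, F z = r → z = a := fun z hz => by
    have h1 := dist_nonneg (x := a) (y := z)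
    have h2 : dist a z = 0 := by simp only [F] at hz; grind
    exact (dist_eq_zero.1 h2).symm
  have heqb : ∀ z, F z = -r → z = b := fun z hz => by
    have h1 := dist_nonneg (x := b) (y := z)
    have h2 : dist b z = 0 := by simp only [F] at hz; grind
    exact (dist_eq_zero.1 h2).symm
  have hlip : ∀ z w, |F z - F w| ≤ 2 * dist z w := fun z w => by
    have h1 := dist_triangle a z w
    have h2 := dist_triangle a w z
    have h3 := dist_triangle b z w
    have h4 := dist_triangle b w z
    have h5 := dist_comm z w
    have h6 := dist_nonneg (x := z) (y := w)
    simp only [F]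
    rw [abs_le]
    constructor <;> grind
  let g : Z → Z → ℝ := fun z w => |F z - F w|
  have hg : IsPseudometric g :=
    ⟨fun z => by simp [g], fun z w => abs_sub_comm _ _, fun z w v => abs_sub_le _ _ _⟩
  have hgle : ∀ z w, g z w ≤ 2 * r := fun z w =>
    abs_le.2 ⟨by linarith [hle w, hge z], by linarith [hle z, hge w]⟩
  have hgab : g a b = 2 * r := by
    simp only [g, hFa, hFb]
    rw [abs_of_nonneg (by linarith)]
    ring
  have hgN : supNorm g = 2 * r :=
    le_antisymm (supNorm_le hgle) (hgab ▸ le_supNorm ⟨_, hgle⟩ a b)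
  have hpeak : Peak g a b := by
    refine ⟨hab, hgab.trans hgN.symm, fun z w _ h => ?_⟩
    rw [hgN] at h
    have h1 := hle z
    have h2 := hle w
    have h3 := hge z
    have h4 := hge w
    rcases abs_choice (F z - F w) with h' | h' <;> simp only [g, h'] at h
    · rw [heqa z (by linarith), heqb w (by linarith)]
    · rw [heqb z (by linarith), heqa w (by linarith), Set.pair_comm]
  refine ⟨(k / 3) • g, mem_LPMlt hZ (hg.smul (by linarith)) (c := k / 3 * 2) (by linarith)
    (by linarith) fun z w => ?_, hpeak.smul (by linarith)⟩
  rw [mul_assoc]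
  exact mul_le_mul_of_nonneg_left (hlip z w) (by linarith)

end Lipschitz

/-- `T` and `S` are mutually inverse isometries between `LPMlt k X` and `LPMlt k Y` which preserve
the existence of a peak. -/
structure PeakIsometry {X Y : Type*} [MetricSpace X] [MetricSpace Y] (k : ℝ)
    (T : (X → X → ℝ) → Y → Y → ℝ) (S : (Y → Y → ℝ) → X → X → ℝ) : Prop where
  pos : 0 < k
  boundedX : ∃ C : ℝ, ∀ a b : X, dist a b ≤ C
  boundedY : ∃ C : ℝ, ∀ a b : Y, dist a b ≤ C
  mapsTo : ∀ d ∈ LPMlt k X, T d ∈ LPMlt k Y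
  mapsTo' : ∀ e ∈ LPMlt k Y, S e ∈ LPMlt k X
  left_inv : ∀ d ∈ LPMlt k X, S (T d) = d
  right_inv : ∀ e ∈ LPMlt k Y, T (S e) = e
  iso : ∀ d ∈ LPMlt k X, ∀ e ∈ LPMlt k X, supDist (T d) (T e) = supDist d e
  peak : ∀ d ∈ LPMlt k X, (∃ a b, Peak d a b) → ∃ x y, Peak (T d) x y
  peak' : ∀ e ∈ LPMlt k Y, (∃ x y, Peak e x y) → ∃ a b, Peak (S e) a b

/-- `T` sends functions peaking at `{a, b}` to functions peaking at `{x, y}`. -/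
def PeakMatch {X Y : Type*} [MetricSpace X] (k : ℝ) (T : (X → X → ℝ) → Y → Y → ℝ)
    (a b : X) (x y : Y) : Prop :=
  a ≠ b ∧ ∀ f ∈ LPMlt k X, Peak f a b → Peak (T f) x y

/-- `T` transports the value at `{a, b}` to the value at `{x, y}` on functions of norm at
most `R`. -/
def TransportsUpTo {X Y : Type*} [MetricSpace X] (k : ℝ) (T : (X → X → ℝ) → Y → Y → ℝ)
    (a b : X) (x y : Y) (R : ℝ) : Prop :=
  ∀ d ∈ LPMlt k X, supNorm d ≤ R → T d x y = d a b

namespace PeakIsometry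

set_option linter.unusedSectionVars false

variable {X Y : Type*} [MetricSpace X] [MetricSpace Y] [Nontrivial X] [Nontrivial Y] {k : ℝ}
  {T : (X → X → ℝ) → Y → Y → ℝ} {S : (Y → Y → ℝ) → X → X → ℝ}
  {a b : X} {x y : Y} {d e : X → X → ℝ}

lemma symm (h : PeakIsometry k T S) : PeakIsometry k S T where
  pos := h.pos
  boundedX := h.boundedY
  boundedY := h.boundedX
  mapsTo := h.mapsTo'
  mapsTo' := h.mapsTo
  left_inv := h.right_inv
  right_inv := h.left_inv
  iso d hd e he := by
    rw [← h.iso _ (h.mapsTo' d hd) _ (h.mapsTo' e he), h.right_inv d hd, h.right_inv e he]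
  peak := h.peak'
  peak' := h.peak

/-- The zero pseudometric is the only one lying strictly between no two others. -/
lemma map_zero (h : PeakIsometry k T S) : T 0 = 0 := by
  have h0X := zero_mem_LPMlt h.boundedX h.pos
  have h0Y := zero_mem_LPMlt h.boundedY h.pos
  have hd := h.mapsTo 0 h0X
  by_contra hne
  have hN : 0 < supNorm (T 0) := by
    by_contra hN
    exact hne (eq_zero_of_supNorm_nonpos hd.1.1 hd.1.2.1 (not_lt.1 hN))
  obtain ⟨ε, hε, hσ⟩ := exists_one_add_smul_mem_LPMlt h.boundedY hd
  have hρX := h.mapsTo' 0 h0Y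
  have hτX := h.mapsTo' _ hσ
  have h1 : supDist (S 0) (S ((1 + ε) • T 0)) = (1 + ε) * supNorm (T 0) := by
    rw [h.symm.iso _ h0Y _ hσ, supDist_zero_left hσ.1.1, supNorm_smul (by linarith)]
  have h2 : supNorm (S 0) = supNorm (T 0) := by
    rw [← supDist_zero_right hρX.1.1, ← h.iso _ hρX _ h0X, h.right_inv _ h0Y,
      supDist_zero_left hd.1.1]
  have h3 : supNorm (S ((1 + ε) • T 0)) = ε * supNorm (T 0) := by
    rw [← supDist_zero_right hτX.1.1, ← h.iso _ hτX _ h0X, h.right_inv _ hσ, add_smul, one_smul,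
      supDist_add_left_self (hd.1.1.smul hε.le), supNorm_smul hε.le]
  have h4 := supDist_le_max hρX.1.1 hτX.1.1 hρX.1.2.1 hτX.1.2.1
  rw [h1, h2, h3] at h4
  rcases le_max_iff.1 h4 with h5 | h5 <;> nlinarith

lemma supNorm_map (h : PeakIsometry k T S) (hd : d ∈ LPMlt k X) :
    supNorm (T d) = supNorm d := by
  rw [← supDist_zero_right (h.mapsTo d hd).1.1, ← supDist_zero_right hd.1.1,
    ← h.iso d hd 0 (zero_mem_LPMlt h.boundedX h.pos), h.map_zero]

lemma abs_map_sub_le (h : PeakIsometry k T S) (hd : d ∈ LPMlt k X)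
    (he : e ∈ LPMlt k X) {δ : ℝ} (hδ : ∀ z w, |d z w - e z w| ≤ δ) (x y : Y) :
    |T d x y - T e x y| ≤ δ := by
  have hTd := h.mapsTo d hd
  have hTe := h.mapsTo e he
  refine (abs_sub_le_supDist hTd.1.1 hTe.1.1 hTd.1.2.1 hTe.1.2.1 x y).trans ?_
  rw [h.iso d hd e he]
  exact supDist_le hδ

lemma peak_pair_eq_of_add (h : PeakIsometry k T S) (hd : d ∈ LPMlt k X)
    (he : e ∈ LPMlt k X) (hde : d + e ∈ LPMlt k X) (hda : Peak d a b) (hea : Peak e a b)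
    {x y x' y' : Y} (hx : Peak (T d) x y) (hx' : Peak (T (d + e)) x' y') :
    ({x, y} : Set Y) = {x', y'} := by
  have hTd := h.mapsTo d hd
  have hTde := h.mapsTo _ hde
  refine hx.pair_eq_of_supDist hTd.1.1 hTde.1.1 hTd.1.2.1 hTde.1.2.1 hx' ?_
  rw [h.iso _ hde _ hd, h.supNorm_map hd, h.supNorm_map hde, supDist_add_left_self he.1.1,
    supNorm_add_of_eq hd.1.2.1 he.1.2.1 hda.2.1 hea.2.1]
  ring

lemma peak_pair_eq (h : PeakIsometry k T S) (hd : d ∈ LPMlt k X)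
    (he : e ∈ LPMlt k X) (hda : Peak d a b) (hea : Peak e a b)
    {x y x' y' : Y} (hx : Peak (T d) x y) (hx' : Peak (T e) x' y') :
    ({x, y} : Set Y) = {x', y'} := by
  have hhalf : (0 : ℝ) < 1 / 2 := by norm_num
  have key : ∀ f ∈ LPMlt k X, ∀ g ∈ LPMlt k X, Peak f a b → Peak g a b →
      ∀ x y x' y', Peak (T ((1 / 2 : ℝ) • f)) x y →
        Peak (T ((1 / 2 : ℝ) • f + (1 / 2 : ℝ) • g)) x' y' → ({x, y} : Set Y) = {x', y'} := by
    intro f hf g hg hfa hga x y x' y' hx hx'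
    exact h.peak_pair_eq_of_add (smul_mem_LPMlt h.boundedX hf hhalf.le (by norm_num))
      (smul_mem_LPMlt h.boundedX hg hhalf.le (by norm_num))
      (convexCombo_mem_LPMlt h.boundedX hf hg hhalf.le hhalf.le (by norm_num))
      (hfa.smul hhalf) (hga.smul hhalf) hx hx'
  have hsum : ∀ f : X → X → ℝ, (1 / 2 : ℝ) • f + (1 / 2 : ℝ) • f = f := fun f => by
    rw [← add_smul]; norm_num
  have hdh := smul_mem_LPMlt h.boundedX hd hhalf.le (by norm_num)
  have heh := smul_mem_LPMlt h.boundedX he hhalf.le (by norm_num)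
  have hm := convexCombo_mem_LPMlt h.boundedX hd he hhalf.le hhalf.le (by norm_num)
  obtain ⟨x₁, y₁, h₁⟩ := h.peak _ hdh ⟨a, b, hda.smul hhalf⟩
  obtain ⟨x₂, y₂, h₂⟩ := h.peak _ heh ⟨a, b, hea.smul hhalf⟩
  obtain ⟨x₃, y₃, h₃⟩ := h.peak _ hm ⟨a, b, Peak.add_of_eq hdh.1.2.1 heh.1.2.1
    (hda.smul hhalf).2.1 (hea.smul hhalf)⟩
  have e₁ := key d hd d hd hda hda _ _ _ _ h₁ ((hsum d).symm ▸ hx)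
  have e₂ := key e he e he hea hea _ _ _ _ h₂ ((hsum e).symm ▸ hx')
  have e₃ := key d hd e he hda hea _ _ _ _ h₁ h₃
  have e₄ := key e he d hd hea hda _ _ _ _ h₂ (add_comm ((1 / 2 : ℝ) • d) _ ▸ h₃)
  rw [← e₁, e₃, ← e₄, e₂]

lemma exists_peakMatch (h : PeakIsometry k T S) (hab : a ≠ b) :
    ∃ x y, PeakMatch k T a b x y := by
  obtain ⟨f, hf, hfa⟩ := exists_peak h.boundedX h.pos hab
  obtain ⟨x, y, hxy⟩ := h.peak f hf ⟨a, b, hfa⟩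
  refine ⟨x, y, hab, fun g hg hga => ?_⟩
  obtain ⟨x', y', hxy'⟩ := h.peak g hg ⟨a, b, hga⟩
  exact hxy'.congr_pair (h.mapsTo g hg).1.1 (h.peak_pair_eq hg hf hga hfa hxy' hxy)

lemma peakMatch_ne (h : PeakIsometry k T S) (hm : PeakMatch k T a b x y) : x ≠ y := by
  obtain ⟨f, hf, hfa⟩ := exists_peak h.boundedX h.pos hm.1
  exact (hm.2 f hf hfa).1

lemma peakMatch_symm (h : PeakIsometry k T S) (hm : PeakMatch k T a b x y) :
    PeakMatch k S x y a b := by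
  obtain ⟨f, hf, hfa⟩ := exists_peak h.boundedX h.pos hm.1
  refine ⟨h.peakMatch_ne hm, fun e he hex => ?_⟩
  obtain ⟨a', b', hea⟩ := h.peak' e he ⟨x, y, hex⟩
  refine hea.congr_pair (h.mapsTo' e he).1.1 ?_
  exact h.symm.peak_pair_eq he (h.mapsTo f hf) hex (hm.2 f hf hfa) hea
    ((h.left_inv f hf).symm ▸ hfa)

lemma peakMatch_pair_eq (h : PeakIsometry k T S) {a' b' : X} {x' y' : Y}
    (hm : PeakMatch k T a b x y) (hm' : PeakMatch k T a' b' x' y')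
    (hab : ({a, b} : Set X) = {a', b'}) : ({x, y} : Set Y) = {x', y'} := by
  obtain ⟨f, hf, hfa⟩ := exists_peak h.boundedX h.pos hm.1
  exact (hm.2 f hf hfa).pair_eq (hm'.2 f hf (hfa.congr_pair hf.1.1 hab))

lemma supNorm_le_map_of_eq (h : PeakIsometry k T S) (hm : PeakMatch k T a b x y)
    (hd : d ∈ LPMlt k X) (hda : d a b = supNorm d) : supNorm d ≤ T d x y := by
  obtain ⟨f, hf, hfa⟩ := exists_peak h.boundedX h.pos hm.1
  have hN := supNorm_nonneg hd.1.1
  have hNf := supNorm_nonneg hf.1.1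
  refine le_of_forall_pos_sub_le fun ε hε => ?_
  obtain ⟨t, ht, ht1, htε⟩ : ∃ t : ℝ, 0 < t ∧ t ≤ 1 ∧ t * (2 * (supNorm d + supNorm f)) ≤ ε := by
    have hpos : 0 < 2 * (supNorm d + supNorm f) + 1 := by linarith
    refine ⟨min 1 (ε / (2 * (supNorm d + supNorm f) + 1)), lt_min one_pos (div_pos hε hpos),
      min_le_left _ _, ?_⟩
    calc _ ≤ ε / (2 * (supNorm d + supNorm f) + 1) * (2 * (supNorm d + supNorm f)) :=
          mul_le_mul_of_nonneg_right (min_le_right _ _) (by linarith)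
      _ ≤ ε / (2 * (supNorm d + supNorm f) + 1) * (2 * (supNorm d + supNorm f) + 1) :=
          mul_le_mul_of_nonneg_left (by linarith) (div_pos hε hpos).le
      _ = ε := div_mul_cancel₀ _ hpos.ne'
  have hdt := smul_mem_LPMlt h.boundedX hd (t := 1 - t) (by linarith) (by linarith)
  have hft := smul_mem_LPMlt h.boundedX hf ht.le ht1
  have hg := convexCombo_mem_LPMlt h.boundedX hd hf (s := 1 - t) (by linarith) ht.le (by ring)
  have hdta : ((1 - t) • d) a b = supNorm ((1 - t) • d) := by
    simp [supNorm_smul (sub_nonneg.2 ht1), hda]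
  have hga := Peak.add_of_eq hdt.1.2.1 hft.1.2.1 hdta (hfa.smul ht)
  have hTg := (hm.2 _ hg hga).2.1
  rw [h.supNorm_map hg, supNorm_add_of_eq hdt.1.2.1 hft.1.2.1 hdta (hfa.smul ht).2.1,
    supNorm_smul (sub_nonneg.2 ht1), supNorm_smul ht.le] at hTg
  have hdist := h.abs_map_sub_le hd hg (δ := t * (supNorm d + supNorm f)) (fun z w => by
    have h1 := mul_le_mul_of_nonneg_left (le_supNorm hd.1.2.1 z w) ht.le
    have h2 := mul_le_mul_of_nonneg_left (le_supNorm hf.1.2.1 z w) ht.le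
    have h3 := mul_nonneg ht.le (hd.1.1.nonneg z w)
    have h4 := mul_nonneg ht.le (hf.1.1.nonneg z w)
    simp only [Pi.add_apply, Pi.smul_apply, smul_eq_mul]
    exact abs_le.2 ⟨by linarith, by linarith⟩) x y
  have h5 := (abs_le.1 hdist).1
  have h6 := mul_nonneg ht.le hNf
  linarith

lemma le_map_of_transportsUpTo (h : PeakIsometry k T S) (hm : PeakMatch k T a b x y) {R : ℝ}
    (hR : TransportsUpTo k T a b x y R) (hd : d ∈ LPMlt k X)
    (hdR : supNorm d + d a b < R + k * dist a b) : d a b ≤ T d x y := by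
  obtain ⟨c, hc, hck, hdc⟩ := exists_bound_of_mem_LPMlt hd
  have hD : 0 < dist a b := dist_pos.2 hm.1
  have hN := le_supNorm hd.1.2.1
  have hn := hd.1.1.nonneg
  obtain ⟨k', hk', hk'k⟩ := exists_between
    (max_lt hck ((div_lt_iff₀ hD).2 (by linarith : supNorm d + d a b - R < k * dist a b)))
  have hck' : c < k' := (le_max_left _ _).trans_lt hk'
  have hRk' : supNorm d + d a b - R < k' * dist a b :=
    (div_lt_iff₀ hD).1 ((le_max_right _ _).trans_lt hk')
  have hdk' : ∀ z w, d z w ≤ k' * dist z w := fun z w =>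
    (hdc z w).trans (mul_le_mul_of_nonneg_right hck'.le dist_nonneg)
  obtain ⟨δ, hδ⟩ : ∃ δ, δ = min ((supNorm d - d a b) / 2) (k' * dist a b - d a b) := ⟨_, rfl⟩
  have hab := hN a b
  have habk := hdk' a b
  have hnab := hn a b
  have hδ1 : δ ≤ (supNorm d - d a b) / 2 := hδ ▸ min_le_left _ _
  have hδ2 : δ ≤ k' * dist a b - d a b := hδ ▸ min_le_right _ _
  have hδ0 : 0 ≤ δ := hδ ▸ le_min (by linarith) (by linarith)
  let e : X → X → ℝ := fun z w => min (supNorm d - δ) (min (d z w + δ) (k' * dist z w))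
  have hep : IsPseudometric e :=
    (hd.1.1.min_add_const (isPseudometric_dist (hc.trans hck'.le)) hdk' hδ0).min_const
      (by linarith)
  have he : e ∈ LPMlt k X := mem_LPMlt h.boundedX hep (hc.trans hck'.le) hk'k fun z w =>
    (min_le_right _ _).trans (min_le_right _ _)
  have heab : e a b = d a b + δ := by
    simp only [e]
    rw [min_eq_left (by linarith : d a b + δ ≤ k' * dist a b), min_eq_right (by linarith)]
  have heN : supNorm e ≤ supNorm d - δ := supNorm_le fun z w => min_le_left _ _
  have hdist := h.abs_map_sub_le hd he (δ := δ) (fun z w => by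
    have h1 := hN z w
    have h2 := hdk' z w
    have h3 : e z w ≤ d z w + δ := (min_le_right _ _).trans (min_le_left _ _)
    have h4 : d z w - δ ≤ e z w := le_min (by linarith) (le_min (by linarith) (by linarith))
    exact abs_le.2 ⟨by linarith, by linarith⟩) x y
  have hkey : e a b ≤ T e x y := by
    rcases min_choice ((supNorm d - d a b) / 2) (k' * dist a b - d a b) with h' | h' <;>
      rw [h'] at hδ
    · have h1 : e a b = supNorm e :=
        le_antisymm (le_supNorm he.1.2.1 a b) (by rw [heab]; linarith)
      rw [h1]
      exact h.supNorm_le_map_of_eq hm he h1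
    · exact (hR e he (by linarith)).ge
  have := (abs_le.1 hdist).1
  linarith

lemma map_le_of_transportsUpTo (h : PeakIsometry k T S) {R : ℝ}
    (hR : TransportsUpTo k T a b x y R) (hd : d ∈ LPMlt k X)
    (hdR : supNorm d - d a b ≤ R) : T d x y ≤ d a b := by
  have hN := le_supNorm hd.1.2.1
  have hn := hd.1.1.nonneg
  have hab := hN a b
  have hnab := hn a b
  let e : X → X → ℝ := fun z w =>
    min (supNorm d - d a b) (min (d z w) (min (d z a + d b w) (d z b + d a w)))
  have hep : IsPseudometric e := (hd.1.1.collapse a b).min_const (by linarith)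
  have hed : ∀ z w, e z w ≤ d z w := fun z w => (min_le_right _ _).trans (min_le_left _ _)
  have he : e ∈ LPMlt k X := mem_LPMlt_of_le h.boundedX hd hep hed
  have heab : e a b = 0 := by
    refine le_antisymm ?_ (hep.nonneg a b)
    refine (min_le_right _ _).trans ((min_le_right _ _).trans ((min_le_left _ _).trans ?_))
    rw [hd.1.1.1, hd.1.1.1, add_zero]
  have heR : supNorm e ≤ R := (supNorm_le fun z w => min_le_left _ _).trans hdR
  have hdist := h.abs_map_sub_le hd he (δ := d a b) (fun z w => by
    have h1 := hN z w
    have h2 := hed z w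
    have h3 := hd.1.1.2.2 z a w
    have h4 := hd.1.1.2.2 a b w
    have h5 := hd.1.1.2.2 z b w
    have h6 := hd.1.1.2.2 b a w
    have h7 := hd.1.1.2.1 a b
    have h8 : d z w - d a b ≤ e z w :=
      le_min (by linarith) (le_min (by linarith) (le_min (by linarith) (by linarith)))
    exact abs_le.2 ⟨by linarith, by linarith⟩) x y
  have h9 := (abs_le.1 hdist).2
  rw [hR e he heR, heab] at h9
  linarith

lemma transportsUpTo_symm (h : PeakIsometry k T S) {R : ℝ}
    (hR : TransportsUpTo k T a b x y R) : TransportsUpTo k S x y a b R := by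
  intro e he heR
  rw [← hR _ (h.mapsTo' e he) (by rwa [h.symm.supNorm_map he]), h.right_inv e he]

lemma map_le_of_supNorm_le_add (h : PeakIsometry k T S) (hm : PeakMatch k T a b x y) {R M : ℝ}
    (hR0 : 0 ≤ R) (hM : M ≤ k * dist x y) (hM0 : 0 < M)
    (hR : TransportsUpTo k T a b x y R) (hd : d ∈ LPMlt k X) (hdR : supNorm d ≤ R + M / 4) :
    T d x y ≤ d a b := by
  rcases le_or_gt (M / 4) (d a b) with hab | hab
  · exact h.map_le_of_transportsUpTo hR hd (by linarith)
  have he : (fun z w => min R (d z w)) ∈ LPMlt k X :=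
    mem_LPMlt_of_le h.boundedX hd (hd.1.1.min_const hR0) fun z w => min_le_right _ _
  have hdist := h.abs_map_sub_le hd he (δ := M / 4) (fun z w => by
    have h1 := le_supNorm hd.1.2.1 z w
    have h2 : min R (d z w) ≤ d z w := min_le_right _ _
    have h3 : d z w - M / 4 ≤ min R (d z w) := le_min (by linarith) (by linarith)
    exact abs_le.2 ⟨by linarith, by linarith⟩) x y
  rw [hR _ he (supNorm_le fun z w => min_le_left _ _)] at hdist
  have h4 := (abs_le.1 hdist).2
  have h5 : min R (d a b) ≤ d a b := min_le_right _ _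
  have h6 := h.symm.le_map_of_transportsUpTo (h.peakMatch_symm hm) (h.transportsUpTo_symm hR)
    (h.mapsTo d hd) (by rw [h.supNorm_map hd]; linarith)
  rwa [h.left_inv d hd] at h6

lemma transportsUpTo_add (h : PeakIsometry k T S) (hm : PeakMatch k T a b x y) {R M : ℝ}
    (hR0 : 0 ≤ R) (hM : M ≤ k * dist a b) (hM' : M ≤ k * dist x y) (hM0 : 0 < M)
    (hR : TransportsUpTo k T a b x y R) : TransportsUpTo k T a b x y (R + M / 4) := by
  intro d hd hdR
  refine le_antisymm (h.map_le_of_supNorm_le_add hm hR0 hM' hM0 hR hd hdR) ?_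
  have := h.symm.map_le_of_supNorm_le_add (h.peakMatch_symm hm) hR0 hM hM0
    (h.transportsUpTo_symm hR) (h.mapsTo d hd) (by rwa [h.supNorm_map hd])
  rwa [h.left_inv d hd] at this

lemma map_apply_eq (h : PeakIsometry k T S) (hm : PeakMatch k T a b x y)
    (hd : d ∈ LPMlt k X) : T d x y = d a b := by
  obtain ⟨M, hM⟩ : ∃ M, M = min (k * dist a b) (k * dist x y) := ⟨_, rfl⟩
  have hM0 : 0 < M := hM ▸ lt_min (mul_pos h.pos (dist_pos.2 hm.1))
    (mul_pos h.pos (dist_pos.2 (h.peakMatch_ne hm)))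
  have key : ∀ n : ℕ, TransportsUpTo k T a b x y (n * (M / 4)) := by
    intro n
    induction n with
    | zero =>
      intro d hd hd0
      rw [eq_zero_of_supNorm_nonpos hd.1.1 hd.1.2.1 (by simpa using hd0), h.map_zero]
      rfl
    | succ n ih =>
      rw [Nat.cast_succ, add_mul, one_mul]
      exact h.transportsUpTo_add hm (by positivity) (hM ▸ min_le_left _ _)
        (hM ▸ min_le_right _ _) hM0 ih
  obtain ⟨n, hn⟩ := exists_nat_ge (supNorm d / (M / 4))
  exact key n d hd ((div_le_iff₀ (by linarith)).1 hn)

end PeakIsometry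

lemma peakIsometry_invFunOn {X Y : Type*} [MetricSpace X] [MetricSpace Y]
    (hX : ∃ C : ℝ, ∀ a b : X, dist a b ≤ C) (hY : ∃ C : ℝ, ∀ a b : Y, dist a b ≤ C)
    {k : ℝ} (hk : 0 < k) {T : (X → X → ℝ) → (Y → Y → ℝ)}
    (hbij : Set.BijOn T (LPMlt k X) (LPMlt k Y))
    (hiso : ∀ d ∈ LPMlt k X, ∀ e ∈ LPMlt k X, supDist (T d) (T e) = supDist d e)
    (hPp : T '' (Pp X ∩ LPMlt k X) = Pp Y ∩ LPMlt k Y) :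
    PeakIsometry k T (Function.invFunOn T (LPMlt k X)) := by
  have hinv := hbij.invOn_invFunOn
  have hmaps := hbij.surjOn.mapsTo_invFunOn
  refine ⟨hk, hX, hY, fun d hd => hbij.mapsTo hd, fun e he => hmaps he, fun d hd => hinv.1 hd,
    fun e he => hinv.2 he, hiso, fun d hd hp => ?_, fun e he hp => ?_⟩
  · have : T d ∈ Pp Y ∩ LPMlt k Y :=
      hPp ▸ mem_image_of_mem T ⟨(mem_Pp_iff_exists_peak hd).2 hp, hd⟩
    exact this.1.2
  · have : e ∈ T '' (Pp X ∩ LPMlt k X) := hPp ▸ ⟨(mem_Pp_iff_exists_peak he).2 hp, he⟩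
    obtain ⟨d, ⟨hdp, hd⟩, rfl⟩ := this
    rw [hinv.1 hd]
    exact hdp.2

theorem stmt15 {X Y : Type*} [MetricSpace X] [MetricSpace Y]
    [Nontrivial X] [Nontrivial Y]
    (hX : ∃ C : ℝ, ∀ a b : X, dist a b ≤ C) (hY : ∃ C : ℝ, ∀ a b : Y, dist a b ≤ C)
    (k : ℝ) (hk : 0 < k)
    (T : (X → X → ℝ) → (Y → Y → ℝ))
    (hbij : Set.BijOn T (LPMlt k X) (LPMlt k Y))
    (hiso : ∀ d ∈ LPMlt k X, ∀ e ∈ LPMlt k X, supDist (T d) (T e) = supDist d e)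
    (hPp : T '' (Pp X ∩ LPMlt k X) = Pp Y ∩ LPMlt k Y) :
    ∃ Φ : Set Y → Set X, Set.BijOn Φ (Dset Y) (Dset X) ∧
      ∀ d ∈ LPMlt k X, ∀ x y : Y, x ≠ y → ∀ z w : X,
        Φ {x, y} = {z, w} → T d x y = d z w := by
  have h := peakIsometry_invFunOn hX hY hk hbij hiso hPp
  have hex : ∀ s : Set Y, ∃ r : Set X, s ∈ Dset Y →
      ∃ x y a b, s = {x, y} ∧ r = {a, b} ∧ PeakMatch k T a b x y := by
    intro s
    by_cases hs : s ∈ Dset Y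
    · obtain ⟨x, y, hxy, rfl⟩ := hs
      obtain ⟨a, b, hm⟩ := h.symm.exists_peakMatch hxy
      exact ⟨{a, b}, fun _ => ⟨x, y, a, b, rfl, rfl, h.symm.peakMatch_symm hm⟩⟩
    · exact ⟨∅, fun hs' => absurd hs' hs⟩
  choose Φ hΦ using hex
  refine ⟨Φ, ⟨?_, ?_, ?_⟩, ?_⟩
  · intro s hs
    obtain ⟨x, y, a, b, -, hr, hm⟩ := hΦ s hs
    exact ⟨a, b, hm.1, hr⟩
  · intro s hs s' hs' hss
    obtain ⟨x, y, a, b, rfl, hr, hm⟩ := hΦ s hs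
    obtain ⟨x', y', a', b', rfl, hr', hm'⟩ := hΦ s' hs'
    exact h.peakMatch_pair_eq hm hm' (hr.symm.trans (hss.trans hr'))
  · rintro _ ⟨a, b, hab, rfl⟩
    obtain ⟨x, y, hm⟩ := h.exists_peakMatch hab
    have hs : ({x, y} : Set Y) ∈ Dset Y := ⟨x, y, h.peakMatch_ne hm, rfl⟩
    refine ⟨_, hs, ?_⟩
    obtain ⟨x', y', a', b', hxy, hr, hm'⟩ := hΦ _ hs
    rw [hr]
    exact h.symm.peakMatch_pair_eq (h.peakMatch_symm hm') (h.peakMatch_symm hm) hxy.symm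
  · intro d hd x y hxy z w hzw
    obtain ⟨x', y', a, b, hs, hr, hm⟩ := hΦ {x, y} ⟨x, y, hxy, rfl⟩
    rw [(h.mapsTo d hd).1.1.eq_of_pair_eq hs, hd.1.1.eq_of_pair_eq (hzw.symm.trans hr)]
    exact h.map_apply_eq hm hd

end BanachStone
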